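/- Let (H, d_H, ι_H) be the data of Example I or Example II, let H ∈ C⁰(X,H) with H ∉ closure(ML(H)), and let Δ, K : ℝ₊ → ℝ₊ be as provided by the uniform growth lemma for H. Then there exists a constant κ > 0 such that the following holds: for any ε > 0, any integer n > K(ε), any x ∈ X and any (H_i)_{i=0}^{n−1} ∈ H^n with d_H(H_i, H(g^i(x))) < κ for all i, one has inf_{y∈ℝ} [(F_{n−1})_ε∘⋯∘(F_0)_ε(y) − F_{n−1}∘⋯∘F_0(y)] > nΔ(ε), where F_i is an arbitrary lift of ι_H(H_i) and (F_i)_ε := F_i + ε. -/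

import Mathlib

open Filter Topology MeasureTheory

namespace ForcedCircle

variable {X : Type*}

/-- Forward fiberwise iteration: `(F^n)_x = F_{g^{n-1} x} ∘ ⋯ ∘ F_x`. -/
def fiberIter (g : X → X) (F : X → ℝ → ℝ) : ℕ → X → ℝ → ℝ
  | 0, _, y => y
  | n + 1, x, y => F (g^[n] x) (fiberIter g F n x y)

/-- Lift data of a `g`-forced circle homeomorphism: a fiberwise increasing
homeomorphism of `ℝ` commuting with `y ↦ y + 1`, jointly continuous. -/
structure ForcedLift [TopologicalSpace X] (g : X → X) where
  F : X → ℝ → ℝ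
  cont : Continuous fun p : X × ℝ => F p.1 p.2
  mono : ∀ x, StrictMono (F x)
  surj : ∀ x, Function.Surjective (F x)
  periodic : ∀ x y, F x (y + 1) = F x y + 1

/-- `Diff^{0,1}_g(X×𝕋)`: fibers are orientation-preserving `C¹` circle
diffeomorphisms depending continuously (in the `C¹` topology) on the base point. -/
structure ForcedC1 [TopologicalSpace X] (g : X → X) extends ForcedLift g where
  fiber_c1 : ∀ x, ContDiff ℝ 1 (F x)
  deriv_pos : ∀ x y, 0 < deriv (F x) y
  deriv_cont : Continuous fun p : X × ℝ => deriv (F p.1) p.2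

/-- `ρ` is the fibered rotation number of the lifted forced system `F`. -/
def HasRotNum (g : X → X) (F : X → ℝ → ℝ) (ρ : ℝ) : Prop :=
  ∀ x y, Tendsto (fun n : ℕ => (fiberIter g F n x y - y) / n) atTop (nhds ρ)

/-- The circle projections of the forced systems lifted by `F` and `F'` are
pointwise within `δ`. -/
def CircleClose (F F' : X → ℝ → ℝ) (δ : ℝ) : Prop :=
  ∀ x y, ∃ m : ℤ, |F' x y - F x y - (m : ℝ)| < δ

/-- Mode-locking: the rotation number (mod `1`) is constant on a `C⁰`
neighbourhood of the forced circle homeomorphism lifted by `F`. -/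
def ModeLocked [TopologicalSpace X] (g : X → X) (F : X → ℝ → ℝ) : Prop :=
  ∃ δ : ℝ, 0 < δ ∧ ∀ F' : ForcedLift g, CircleClose F F'.F δ →
    ∀ ρ ρ' : ℝ, HasRotNum g F ρ → HasRotNum g F'.F ρ' → ∃ m : ℤ, ρ' = ρ + (m : ℝ)

/-- `g` admits exactly one invariant Borel probability measure. -/
def UniquelyErgodic [MeasurableSpace X] (g : X → X) : Prop :=
  ∃! μ : ProbabilityMeasure X, Measure.map g (μ : Measure X) = (μ : Measure X)

def Minimal [TopologicalSpace X] (g : X → X) : Prop :=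
  ∀ x, Dense (Set.range fun n : ℕ => g^[n] x)

/-- `g` has a non-periodic factor of finite dimension: an infinite compact
subset of some Euclidean space carrying a homeomorphic factor of `g`. -/
def HasFinDimNonperiodicFactor [TopologicalSpace X] (g : X → X) : Prop :=
  ∃ (d : ℕ) (Y : Set (Fin d → ℝ)) (gbar : Y ≃ₜ Y) (h : X → Y),
    Y.Infinite ∧ IsCompact Y ∧ Continuous h ∧ Function.Surjective h ∧
      ∀ x, h (g x) = gbar (h x)

/-- The range of the Schwartzman asymptotic cycle of `g` (w.r.t. the invariant
measure `ν`). -/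
def SchwartzmanGroup [TopologicalSpace X] [MeasurableSpace X] (g : X → X)
    (ν : Measure X) : Set ℝ :=
  {t | ∃ (φ : X → ℝ) (ψ : X → AddCircle (1 : ℝ)), Continuous φ ∧ Continuous ψ ∧
    t = ∫ x, φ x ∂ν ∧ ∀ x, ψ (g x) - ψ x = ((φ x : ℝ) : AddCircle (1 : ℝ))}

/-- A lift of an orientation-preserving `C^r` circle diffeomorphism. -/
def IsCrLift (r : ℕ∞) (f : ℝ → ℝ) : Prop :=
  ContDiff ℝ r f ∧ (∀ y, 0 < deriv f y) ∧ ∀ y, f (y + 1) = f y + 1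

/-- Abstract data `(ℋ, d_ℋ, ι_ℋ)`: a space with a distance and a map into
(lifts of) `C¹` circle diffeomorphisms. -/
structure HData where
  H : Type
  dist : H → H → ℝ
  iota : H → ℝ → ℝ
  iota_lift : ∀ h, IsCrLift 1 (iota h)

noncomputable def crDist (r : ℕ) (f g : ℝ → ℝ) : ℝ :=
  ∑ k ∈ Finset.range (r + 1), ⨆ y : ℝ, |iteratedDeriv k f y - iteratedDeriv k g y|

noncomputable def liftDist (r : ℕ) (f g : ℝ → ℝ) : ℝ :=
  crDist r f g + crDist r (Function.invFun f) (Function.invFun g)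

noncomputable def liftDistInf (f g : ℝ → ℝ) : ℝ :=
  ∑' k : ℕ, (2 : ℝ)⁻¹ ^ (k + 1) * (liftDist (k + 1) f g / (liftDist (k + 1) f g + 1))

/-- Example I: `ℋ = widetilde{Diff}^r(𝕋)` with the `C^r` metric (including inverses). -/
def HData.IsExampleI (hd : HData) : Prop :=
  ∃ r : ℕ∞, 1 ≤ r ∧ ∃ e : hd.H ≃ {f : ℝ → ℝ // IsCrLift r f},
    (∀ h, hd.iota h = (e h).1) ∧
    (∀ n : ℕ, r = (n : ℕ∞) → ∀ h h', hd.dist h h' = liftDist n (e h).1 (e h').1) ∧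
    (r = ⊤ → ∀ h h', hd.dist h h' = liftDistInf (e h).1 (e h').1)

/-- `P` is (the lift of) a non-constant real-analytic function on `𝕋` with
`‖P'‖ < 1`. -/
def GoodP (P : ℝ → ℝ) : Prop :=
  AnalyticOnNhd ℝ P Set.univ ∧ (∀ y, P (y + 1) = P y) ∧ (∃ a b, P a ≠ P b) ∧
    ∀ y, |deriv P y| < 1

/-- `P` has no smaller period. -/
def NoSmallerPeriod (P : ℝ → ℝ) : Prop :=
  ¬ ∃ ρ ∈ Set.Ioo (0 : ℝ) 1, ∀ w, P (w + ρ) = P w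

/-- Example III with explicit witnesses: `ℋ = ℝ`, `ι_ℋ(h)(w) = w + P(w) + h`. -/
def HData.IsExampleIIIWith (hd : HData) (P : ℝ → ℝ) (e : hd.H ≃ ℝ) : Prop :=
  GoodP P ∧ (∀ h h', hd.dist h h' = |e h - e h'|) ∧ ∀ h y, hd.iota h y = y + P y + e h

def HData.IsExampleIII (hd : HData) : Prop := ∃ P e, hd.IsExampleIIIWith P e

/-- Example II: Example III where moreover `P` has no smaller period. -/
def HData.IsExampleIIWith (hd : HData) (P : ℝ → ℝ) (e : hd.H ≃ ℝ) : Prop :=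
  hd.IsExampleIIIWith P e ∧ NoSmallerPeriod P

def HData.IsExampleII (hd : HData) : Prop := ∃ P e, hd.IsExampleIIWith P e

/-- Continuity of `H : X → ℋ` with respect to `d_ℋ`. -/
def ContH [TopologicalSpace X] (hd : HData) (H : X → hd.H) : Prop :=
  ∀ (x : X) (ε : ℝ), 0 < ε → ∃ U ∈ nhds x, ∀ x' ∈ U, hd.dist (H x) (H x') < ε

/-- The metric `D_ℋ` on `C⁰(X, ℋ)`. -/
noncomputable def DH (hd : HData) (H H' : X → hd.H) : ℝ :=
  ⨆ x : X, hd.dist (H x) (H' x)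

/-- The lift of `Φ(H)`. -/
def Phi (hd : HData) (H : X → hd.H) : X → ℝ → ℝ := fun x => hd.iota (H x)

/-- `S` is open in `(C⁰(X,ℋ), D_ℋ)`. -/
def OpenInC0 [TopologicalSpace X] (hd : HData) (S : Set (X → hd.H)) : Prop :=
  ∀ H, ContH hd H → H ∈ S → ∃ ε : ℝ, 0 < ε ∧
    ∀ H', ContH hd H' → DH hd H H' < ε → H' ∈ S

/-- `S` is dense in `(C⁰(X,ℋ), D_ℋ)`. -/
def DenseInC0 [TopologicalSpace X] (hd : HData) (S : Set (X → hd.H)) : Prop :=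
  ∀ H, ContH hd H → ∀ ε : ℝ, 0 < ε → ∃ H', ContH hd H' ∧ DH hd H H' < ε ∧ H' ∈ S

/-- `H` lies in the closure of `𝓜𝓛(ℋ)` inside `(C⁰(X,ℋ), D_ℋ)`. -/
def InClosureML [TopologicalSpace X] (hd : HData) (g : X → X) (H : X → hd.H) : Prop :=
  ∀ ε : ℝ, 0 < ε → ∃ H', ContH hd H' ∧ DH hd H H' < ε ∧ ModeLocked g (Phi hd H')

/-- The complement of the closure of `𝓜𝓛(ℋ)` in `C⁰(X,ℋ)`. -/
def C0NotClosML [TopologicalSpace X] (hd : HData) (g : X → X) : Set (X → hd.H) :=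
  {H | ContH hd H ∧ ¬ InClosureML hd g H}

/-- Relative openness in `C⁰(X,ℋ) \ closure(𝓜𝓛(ℋ))`. -/
def OpenInCompl [TopologicalSpace X] (hd : HData) (g : X → X) (S : Set (X → hd.H)) : Prop :=
  ∀ H ∈ S ∩ C0NotClosML hd g, ∃ ε : ℝ, 0 < ε ∧
    ∀ H' ∈ C0NotClosML hd g, DH hd H H' < ε → H' ∈ S

/-- Relative density in `C⁰(X,ℋ) \ closure(𝓜𝓛(ℋ))`. -/
def DenseInCompl [TopologicalSpace X] (hd : HData) (g : X → X) (S : Set (X → hd.H)) : Prop :=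
  ∀ H ∈ C0NotClosML hd g, ∀ ε : ℝ, 0 < ε → ∃ H' ∈ C0NotClosML hd g ∩ S, DH hd H H' < ε

/-- `L` is the upper extremal fiberwise Lyapunov exponent `L₊`. -/
def HasLplus (g : X → X) (F : X → ℝ → ℝ) (L : ℝ) : Prop :=
  Tendsto (fun n : ℕ => (⨆ p : X × ℝ, Real.log (deriv (fiberIter g F n p.1) p.2)) / n)
    atTop (nhds L)

/-- `L` is the lower extremal fiberwise Lyapunov exponent `L₋`. -/
def HasLminus (g : X → X) (F : X → ℝ → ℝ) (L : ℝ) : Prop :=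
  Tendsto (fun n : ℕ => (⨅ p : X × ℝ, Real.log (deriv (fiberIter g F n p.1) p.2)) / n)
    atTop (nhds L)

/-- `‖f‖_{C^{0,1}} = sup_x max(‖Df_x‖, ‖D(f_x⁻¹)‖)`. -/
noncomputable def Cnorm (F : X → ℝ → ℝ) : ℝ :=
  ⨆ p : X × ℝ, max (deriv (F p.1) p.2) (deriv (F p.1) p.2)⁻¹

/-- Composition of a list of maps, first element applied first. -/
def compList : List (ℝ → ℝ) → ℝ → ℝ
  | [], y => y
  | f :: l, y => compList l (f y)

/-- `ι_ℋ(h_{n-1}) ∘ ⋯ ∘ ι_ℋ(h_0)`. -/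
noncomputable def tupleComp (hd : HData) {n : ℕ} (p : Fin n → hd.H) : ℝ → ℝ :=
  compList (List.ofFn fun i => hd.iota (p i))

/-- `𝐋₊` of a tuple. -/
noncomputable def bLplus (hd : HData) {n : ℕ} (p : Fin n → hd.H) : ℝ :=
  (⨆ y : ℝ, Real.log (deriv (tupleComp hd p) y)) / n

/-- `𝐋₋` of a tuple. -/
noncomputable def bLminus (hd : HData) {n : ℕ} (p : Fin n → hd.H) : ℝ :=
  (⨅ y : ℝ, Real.log (deriv (tupleComp hd p) y)) / n

/-- The quantitative contractability condition of Example II, w.r.t. `P`. -/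
def ContractableWith (g : X → X) (P : ℝ → ℝ) (F : X → ℝ → ℝ) : Prop :=
  ∃ k : ℕ, 1 < k ∧ ∀ (x : X) (w : ℝ), ∃ i : ℕ, i ≤ k - 2 ∧
    deriv (deriv P) (fiberIter g F (i + 1) x w) ≠ 0

/-- `H ∈ C⁰(X,ℋ)` is contractable. -/
def Contractable [TopologicalSpace X] (hd : HData) (g : X → X) (H : X → hd.H) : Prop :=
  hd.IsExampleI ∨ ∃ P e, hd.IsExampleIIWith P e ∧ ContractableWith g P (Phi hd H)

/-- `F` is a lift of `Φ(H)`. -/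
def IsLiftOfPhi [TopologicalSpace X] (hd : HData) (H : X → hd.H) (F : X → ℝ → ℝ) : Prop :=
  ∃ m : X → ℤ, Continuous (fun x => (m x : ℝ)) ∧ ∀ x y, F x y = hd.iota (H x) y + (m x : ℝ)

/-- `M̲(F,n)`. -/
noncomputable def Mlow (g : X → X) (F : X → ℝ → ℝ) (n : ℕ) : ℝ :=
  ⨅ p : X × ℝ, (fiberIter g F n p.1 p.2 - p.2)

/-- `M̄(F,n)`. -/
noncomputable def Mup (g : X → X) (F : X → ℝ → ℝ) (n : ℕ) : ℝ :=
  ⨆ p : X × ℝ, (fiberIter g F n p.1 p.2 - p.2)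

end ForcedCircle

namespace ForcedCircle

section Growth

/-- Continuous convergence: joint convergence in the parameter and the argument. -/
def ContConv {ι : Type*} (l : Filter ι) (F : ι → ℝ → ℝ) (f : ℝ → ℝ) : Prop :=
  ∀ y₀, Tendsto (fun p : ι × ℝ => F p.1 p.2) (l ×ˢ 𝓝 y₀) (𝓝 (f y₀))

/-- A system of observables identifying `d_ℋ`-convergence, together with an interpolation
between elements of `ℋ` on which the observables are affine. -/
structure ConvexModel (hd : HData) where
  S : Set ℕ
  J : ℕ → hd.H → ℝ → ℝ
  mix : hd.H → hd.H → unitInterval → hd.H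
  mix_zero : ∀ a b, mix a b 0 = a
  mix_one : ∀ a b, mix a b 1 = b
  J_mix : ∀ k ∈ S, ∀ a b t y, J k (mix a b t) y = (1 - t) * J k a y + t * J k b y
  J_cont : ∀ k ∈ S, ∀ h, Continuous (J k h)
  dist_comm : ∀ a b, hd.dist a b = hd.dist b a
  dist_nonneg : ∀ a b, 0 ≤ hd.dist a b
  conv_of_dist : ∀ {ι : Type} (l : Filter ι) (F G : ι → hd.H) (f : hd.H),
    Tendsto (fun i => hd.dist (F i) (G i)) l (𝓝 0) →
    (∀ k ∈ S, ContConv l (fun i => J k (G i)) (J k f)) →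
    ∀ k ∈ S, ContConv l (fun i => J k (F i)) (J k f)
  dist_of_conv : ∀ {ι : Type} (l : Filter ι) (F G : ι → hd.H) (f : hd.H),
    (∀ k ∈ S, ContConv l (fun i => J k (F i)) (J k f)) →
    (∀ k ∈ S, ContConv l (fun i => J k (G i)) (J k f)) →
    Tendsto (fun i => hd.dist (F i) (G i)) l (𝓝 0)

namespace ConvexModel

variable {hd : HData} (M : ConvexModel hd)

/-- Convergence of all observables of the model. -/
def Conv {ι : Type} (l : Filter ι) (F : ι → hd.H) (f : hd.H) : Prop :=
  ∀ k ∈ M.S, ContConv l (fun i => M.J k (F i)) (M.J k f)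

lemma conv_const {ι : Type} (l : Filter ι) (f : hd.H) : M.Conv l (fun _ => f) f :=
  fun k hk y₀ => ((M.J_cont k hk f).tendsto y₀).comp tendsto_snd

variable {M}

lemma Conv.comp {ι κ : Type} {l : Filter ι} {l' : Filter κ} {F : ι → hd.H} {f : hd.H}
    (hF : M.Conv l F f) {u : κ → ι} (hu : Tendsto u l' l) :
    M.Conv l' (fun i => F (u i)) f :=
  fun k hk y₀ => (hF k hk y₀).comp (hu.prodMap tendsto_id)

lemma Conv.mix {ι : Type} {l : Filter ι} {F G : ι → hd.H} {f g : hd.H}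
    (hF : M.Conv l F f) (hG : M.Conv l G g) {t : ι → unitInterval} {t₀ : unitInterval}
    (ht : Tendsto t l (𝓝 t₀)) :
    M.Conv l (fun i => M.mix (F i) (G i) (t i)) (M.mix f g t₀) := by
  intro k hk y₀
  simp only [M.J_mix k hk]
  have ht' : Tendsto (fun p : ι × ℝ => (t p.1 : ℝ)) (l ×ˢ 𝓝 y₀) (𝓝 (t₀ : ℝ)) :=
    ((continuous_subtype_val.tendsto t₀).comp ht).comp tendsto_fst
  exact ((ht'.const_sub 1).mul (hF k hk y₀)).add (ht'.mul (hG k hk y₀))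

lemma Conv.mix_self {ι : Type} {l : Filter ι} {F G : ι → hd.H} {f : hd.H}
    (hF : M.Conv l F f) (hG : M.Conv l G f) (t : ι → unitInterval) :
    M.Conv l (fun i => M.mix (F i) (G i) (t i)) f := by
  intro k hk y₀
  simp only [M.J_mix k hk]
  rw [Metric.tendsto_nhds]
  intro ε hε
  filter_upwards [Metric.tendsto_nhds.1 (hF k hk y₀) ε hε,
    Metric.tendsto_nhds.1 (hG k hk y₀) ε hε] with p h₁ h₂
  exact (convex_ball (M.J k f y₀) ε) h₁ h₂ (sub_nonneg.2 (t p.1).2.2) (t p.1).2.1 (by ring)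

variable {X : Type}

lemma conv_of_contH [TopologicalSpace X] {H : X → hd.H} (hH : ContH hd H) (x : X) :
    M.Conv (𝓝 x) H (H x) := by
  refine M.conv_of_dist (𝓝 x) H (fun _ => H x) (H x) ?_ (M.conv_const _ _)
  rw [Metric.tendsto_nhds]
  intro ε hε
  obtain ⟨U, hU, h⟩ := hH x ε hε
  filter_upwards [hU] with y hy
  rw [Real.dist_0_eq_abs, abs_of_nonneg (M.dist_nonneg _ _), M.dist_comm]
  exact h y hy

lemma contH_of_conv [TopologicalSpace X] {H : X → hd.H} (h : ∀ x, M.Conv (𝓝 x) H (H x)) :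
    ContH hd H := by
  intro x ε hε
  have := M.dist_of_conv (𝓝 x) (fun _ => H x) H (H x) (M.conv_const _ _) (h x)
  exact ⟨_, this.eventually_lt_const hε, fun _ hy => hy⟩

lemma contH_mix [TopologicalSpace X] {H : X → hd.H} (hH : ContH hd H) (p : hd.H)
    {t : X → unitInterval} (ht : Continuous t) :
    ContH hd (fun y => M.mix (H y) p (t y)) :=
  contH_of_conv (M := M) fun x =>
    (conv_of_contH hH x).mix (M.conv_const _ p) (ht.tendsto x)

lemma exists_local_bound [MetricSpace X] {H : X → hd.H} (hH : ContH hd H) {η : ℝ} (hη : 0 < η)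
    (x₀ : X) : ∃ δ > 0, ∀ x ∈ Metric.ball x₀ δ, ∀ y ∈ Metric.ball x₀ δ, ∀ p t,
      hd.dist p (H x) < δ → hd.dist (H y) (M.mix (H y) p t) < η := by
  by_contra! hcon
  choose x hx y hy p t hp hge using fun n : ℕ => hcon (1 / ((n : ℝ) + 1)) (by positivity)
  have h0 := tendsto_one_div_add_atTop_nhds_zero_nat (𝕜 := ℝ)
  have hx' : Tendsto x atTop (𝓝 x₀) := tendsto_iff_dist_tendsto_zero.2 <|
    squeeze_zero (fun _ => _root_.dist_nonneg) (fun n => (hx n).le) h0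
  have hy' : Tendsto y atTop (𝓝 x₀) := tendsto_iff_dist_tendsto_zero.2 <|
    squeeze_zero (fun _ => _root_.dist_nonneg) (fun n => (hy n).le) h0
  have hHy : M.Conv atTop (fun n => H (y n)) (H x₀) := (conv_of_contH hH x₀).comp hy'
  have hpc : M.Conv atTop p (H x₀) :=
    M.conv_of_dist _ _ (fun n => H (x n)) _
      (squeeze_zero (fun _ => M.dist_nonneg _ _) (fun n => (hp n).le) h0)
      ((conv_of_contH hH x₀).comp hx')
  obtain ⟨n, hn⟩ := ((M.dist_of_conv _ _ _ _ hHy (hHy.mix_self hpc t)).eventually_lt_const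
    hη).exists
  exact (hge n).not_gt hn

lemma exists_uniform_bound [MetricSpace X] [CompactSpace X] {H : X → hd.H} (hH : ContH hd H)
    {η : ℝ} (hη : 0 < η) : ∃ κ > 0, ∀ x p, hd.dist p (H x) < κ →
      ∃ U ∈ 𝓝 x, ∀ y ∈ U, ∀ t, hd.dist (H y) (M.mix (H y) p t) < η := by
  have key : ∃ κ > 0, ∀ x ∈ (Set.univ : Set X), ∀ p, hd.dist p (H x) < κ →
      ∃ U ∈ 𝓝 x, ∀ y ∈ U, ∀ t, hd.dist (H y) (M.mix (H y) p t) < η := by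
    refine isCompact_univ.induction_on (p := fun s : Set X => ∃ κ > 0, ∀ x ∈ s, ∀ p,
      hd.dist p (H x) < κ → ∃ U ∈ 𝓝 x, ∀ y ∈ U, ∀ t, hd.dist (H y) (M.mix (H y) p t) < η)
      ⟨1, one_pos, by simp⟩ ?_ ?_ ?_
    · rintro s s' hs ⟨κ, hκ, h⟩
      exact ⟨κ, hκ, fun x hx => h x (hs hx)⟩
    · rintro s s' ⟨κ, hκ, h⟩ ⟨κ', hκ', h'⟩
      refine ⟨min κ κ', lt_min hκ hκ', fun x hx p hp => ?_⟩
      rcases hx with hx | hx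
      · exact h x hx p (hp.trans_le (min_le_left _ _))
      · exact h' x hx p (hp.trans_le (min_le_right _ _))
    · intro x₀ _
      obtain ⟨δ, hδ, h⟩ := exists_local_bound (M := M) hH hη x₀
      refine ⟨Metric.ball x₀ δ, mem_nhdsWithin_of_mem_nhds (Metric.ball_mem_nhds _ hδ), δ, hδ,
        fun x hx p hp => ⟨_, Metric.isOpen_ball.mem_nhds hx, fun y hy t => h x hx y hy p t hp⟩⟩
  simpa using key

/-- A tent function with peak at `c` and support in the ball of radius `r`. -/
noncomputable def tent [MetricSpace X] (c : X) (r : ℝ) (y : X) : unitInterval :=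
  Set.projIcc 0 1 zero_le_one (1 - dist y c / r)

lemma continuous_tent [MetricSpace X] (c : X) (r : ℝ) : Continuous (tent c r) :=
  (continuous_projIcc (h := zero_le_one (α := ℝ))).comp (by fun_prop)

lemma tent_self [MetricSpace X] (c : X) (r : ℝ) : tent c r c = 1 := by
  unfold tent
  simp only [dist_self, zero_div, sub_zero]
  exact Set.projIcc_right (h := zero_le_one (α := ℝ))

lemma tent_eq_zero [MetricSpace X] {c y : X} {r : ℝ} (hr : 0 < r) (h : r ≤ dist y c) :
    tent c r y = 0 :=
  Set.projIcc_of_le_left _ (by rw [sub_nonpos, one_le_div hr]; exact h)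

lemma exists_interpolation [MetricSpace X] {H : X → hd.H} (hH : ContH hd H) {ι : Type}
    (c : ι → X) (p : ι → hd.H) {r : ℝ} (hr : 0 < r)
    (hc : ∀ i j, i ≠ j → 2 * r ≤ dist (c i) (c j)) (s : Finset ι) :
    ∃ H' : X → hd.H, ContH hd H' ∧ (∀ y, (∀ i ∈ s, r ≤ dist y (c i)) → H' y = H y) ∧
      ∀ i ∈ s, ∀ y, dist y (c i) < r → H' y = M.mix (H y) (p i) (tent (c i) r y) := by
  classical
  have hfar : ∀ i j y, i ≠ j → dist y (c i) < r → r ≤ dist y (c j) := by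
    intro i j y hij hy
    have := hc i j hij
    have := dist_triangle_left (c i) (c j) y
    linarith
  induction s using Finset.induction_on with
  | empty => exact ⟨H, hH, fun _ _ => rfl, by simp⟩
  | insert j s hj ih =>
    obtain ⟨H', hH', hout, hin⟩ := ih
    refine ⟨_, contH_mix (M := M) hH' (p j) (continuous_tent (c j) r), ?_, ?_⟩
    · intro y hy
      rw [tent_eq_zero hr (hy j (Finset.mem_insert_self _ _)), M.mix_zero]
      exact hout y fun i hi => hy i (Finset.mem_insert_of_mem hi)
    · intro i hi y hy
      rcases Finset.mem_insert.1 hi with rfl | hi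
      · rw [hout y fun k hk => hfar i k y (fun h => hj (h ▸ hk)) hy]
      · have hij : i ≠ j := fun h => hj (h ▸ hi)
        simp only [tent_eq_zero hr (hfar i j y hij hy), M.mix_zero]
        exact hin i hi y hy

/-- Elements of `ℋ` close to the values of `H` at finitely many distinct points are themselves
the values at these points of some map in `C⁰(X,ℋ)` close to `H`. -/
lemma exists_extension (M : ConvexModel hd) [MetricSpace X] [CompactSpace X] {H : X → hd.H}
    (hH : ContH hd H) {η : ℝ} (hη : 0 < η) :
    ∃ κ > 0, ∀ {ι : Type} [Finite ι] (c : ι → X) (p : ι → hd.H), Function.Injective c →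
      (∀ i, hd.dist (p i) (H (c i)) < κ) →
      ∃ H' : X → hd.H, ContH hd H' ∧ DH hd H H' < η ∧ ∀ i, H' (c i) = p i := by
  obtain ⟨κ, hκ, h⟩ := exists_uniform_bound (M := M) hH (half_pos hη)
  refine ⟨κ, hκ, fun {ι} _ c p hc hp => ?_⟩
  choose U hU hUb using fun i => h (c i) (p i) (hp i)
  have hsub : ∀ i, ∀ᶠ r in 𝓝[>] (0 : ℝ), Metric.ball (c i) r ⊆ U i := by
    intro i
    obtain ⟨r, hr, hrU⟩ := Metric.mem_nhds_iff.1 (hU i)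
    filter_upwards [Ioo_mem_nhdsGT hr] with r' hr'
    exact (Metric.ball_subset_ball hr'.2.le).trans hrU
  have hsep : ∀ i j, ∀ᶠ r in 𝓝[>] (0 : ℝ), i ≠ j → 2 * r ≤ dist (c i) (c j) := by
    intro i j
    by_cases hij : i = j
    · simp [hij]
    · have : 0 < dist (c i) (c j) / 2 := half_pos (dist_pos.2 (hc.ne hij))
      filter_upwards [Ioo_mem_nhdsGT this] with r' hr' _
      linarith [hr'.2]
  obtain ⟨r, ⟨hrU, hrs⟩, hr⟩ := (((eventually_all.2 hsub).and
    (eventually_all.2 fun i => eventually_all.2 (hsep i))).and self_mem_nhdsWithin).exists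
  have hr : 0 < r := hr
  have := Fintype.ofFinite ι
  obtain ⟨H', hH', hout, hin⟩ := exists_interpolation (M := M) hH c p hr hrs Finset.univ
  refine ⟨H', hH', ?_, fun i => ?_⟩
  · refine (Real.iSup_le (fun y => ?_) (half_pos hη).le).trans_lt (half_lt_self hη)
    by_cases hy : ∃ i, dist y (c i) < r
    · obtain ⟨i, hi⟩ := hy
      rw [hin i (Finset.mem_univ _) y hi]
      exact (hUb i y (hrU i hi) _).le
    · push Not at hy
      rw [hout y fun i _ => hy i]
      obtain ⟨V, hV, hVb⟩ := hH y _ (half_pos hη)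
      exact (hVb y (mem_of_mem_nhds hV)).le
  · rw [hin i (Finset.mem_univ _) _ (by simpa using hr), tent_self, M.mix_one]

end ConvexModel

lemma iterate_injective_of_minimal {X : Type} [TopologicalSpace X] [T1Space X] [Infinite X]
    {g : X → X} (hg : Function.Injective g) (hmin : Minimal g) (x : X) :
    Function.Injective fun n : ℕ => g^[n] x := by
  by_contra hinj
  have hmem : x ∈ Function.periodicPts g := by
    simp only [Function.Injective, not_forall] at hinj
    obtain ⟨i, j, hij, hne⟩ := hinj
    wlog hlt : i < j generalizing i j
    · exact this j i hij.symm (Ne.symm hne) (by omega)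
    refine ⟨j - i, by omega, hg.iterate i ?_⟩
    rw [← Function.iterate_add_apply, Nat.add_sub_cancel' hlt.le]
    exact hij.symm
  have hfin : (Set.range fun n : ℕ => g^[n] x).Finite := by
    refine ((Finset.range (Function.minimalPeriod g x)).finite_toSet.image
      fun n => g^[n] x).subset ?_
    rintro _ ⟨n, rfl⟩
    refine ⟨n % Function.minimalPeriod g x, ?_, Function.iterate_mod_minimalPeriod_eq⟩
    simpa using Nat.mod_lt _ (Function.minimalPeriod_pos_of_mem_periodicPts hmem)
  have hu := (hmin x).closure_eq
  rw [hfin.isClosed.closure_eq] at hu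
  exact Set.infinite_univ (hu ▸ hfin)

lemma infinite_of_factor {X : Type} [TopologicalSpace X] {g : X → X}
    (h : HasFinDimNonperiodicFactor g) : Infinite X := by
  obtain ⟨d, Y, _, f, hY, _, _, hf, _⟩ := h
  have := hY.to_subtype
  exact Infinite.of_surjective f hf

lemma apply_add_int {f : ℝ → ℝ} (hf : ∀ y, f (y + 1) = f y + 1) (y : ℝ) (m : ℤ) :
    f (y + m) = f y + m := by
  have h : ∀ (n : ℕ) y, f (y + n) = f y + n := by
    intro n
    induction n with
    | zero => simp
    | succ n ih => intro y; push_cast; rw [← add_assoc, hf, ih, add_assoc]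
  obtain ⟨n, rfl | rfl⟩ := m.eq_nat_or_neg
  · exact_mod_cast h n y
  · have := h n (y + -n)
    push_cast
    simp only [neg_add_cancel_right] at this
    linarith

lemma compList_append (l l' : List (ℝ → ℝ)) (y : ℝ) :
    compList (l ++ l') y = compList l' (compList l y) := by
  induction l generalizing y with
  | nil => rfl
  | cons f l ih => exact ih (f y)

/-- Integer translations of the fibre maps add up along an orbit. -/
lemma compList_ofFn_add_int {X : Type} (g : X → X) (F : X → ℝ → ℝ)
    (hF : ∀ x y, F x (y + 1) = F x y + 1) (n : ℕ) (x : X) (y : ℝ) (a : Fin n → ℤ) :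
    compList (List.ofFn fun i : Fin n => fun u => F (g^[(i : ℕ)] x) u + (a i : ℝ)) y =
      fiberIter g F n x y + ((∑ i, a i : ℤ) : ℝ) := by
  induction n with
  | zero => simp [compList, fiberIter]
  | succ n ih =>
    rw [List.ofFn_succ', List.concat_eq_append, compList_append]
    simp only [Fin.val_castSucc, Fin.val_last]
    rw [ih fun i => a i.castSucc, Fin.sum_univ_castSucc]
    simp only [compList, fiberIter]
    rw [apply_add_int (hF _)]
    push_cast
    ring

/-- Continuous convergence of all derivatives up to order `k`. -/
def CkConv {ι : Type*} (l : Filter ι) : ℕ → (ι → ℝ → ℝ) → (ℝ → ℝ) → Prop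
  | 0, F, f => ContConv l F f
  | k + 1, F, f => ContConv l F f ∧ (∀ i, Differentiable ℝ (F i)) ∧ Differentiable ℝ f ∧
      CkConv l k (fun i => deriv (F i)) (deriv f)

section CkConv

variable {ι : Type*} {l : Filter ι} {k : ℕ} {F G : ι → ℝ → ℝ} {f g : ℝ → ℝ}

lemma CkConv.contConv (h : CkConv l k F f) : ContConv l F f := by
  cases k with
  | zero => exact h
  | succ k => exact h.1

lemma CkConv.of_succ (h : CkConv l (k + 1) F f) : CkConv l k F f := by
  induction k generalizing F f with
  | zero => exact h.1
  | succ k ih => exact ⟨h.1, h.2.1, h.2.2.1, ih h.2.2.2⟩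

lemma ContConv.add (hF : ContConv l F f) (hG : ContConv l G g) :
    ContConv l (fun i y => F i y + G i y) (fun y => f y + g y) :=
  fun y => (hF y).add (hG y)

lemma ContConv.mul (hF : ContConv l F f) (hG : ContConv l G g) :
    ContConv l (fun i y => F i y * G i y) (fun y => f y * g y) :=
  fun y => (hF y).mul (hG y)

lemma ContConv.comp (hF : ContConv l F f) (hG : ContConv l G g) :
    ContConv l (fun i y => F i (G i y)) (fun y => f (g y)) :=
  fun y => (hF (g y)).comp (tendsto_fst.prodMk (hG y))

lemma ContConv.inv (hF : ContConv l F f) (hf : ∀ y, f y ≠ 0) :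
    ContConv l (fun i y => (F i y)⁻¹) (fun y => (f y)⁻¹) :=
  fun y => (hF y).inv₀ (hf y)

lemma CkConv.add (hF : CkConv l k F f) (hG : CkConv l k G g) :
    CkConv l k (fun i y => F i y + G i y) (fun y => f y + g y) := by
  induction k generalizing F G f g with
  | zero => exact ContConv.add hF hG
  | succ k ih =>
    obtain ⟨hF₀, hF₁, hf₁, hF₂⟩ := hF
    obtain ⟨hG₀, hG₁, hg₁, hG₂⟩ := hG
    refine ⟨hF₀.add hG₀, fun i => (hF₁ i).add (hG₁ i), hf₁.add hg₁, ?_⟩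
    convert ih hF₂ hG₂ using 1
    · ext i y; exact deriv_fun_add (hF₁ i y) (hG₁ i y)
    · ext y; exact deriv_fun_add (hf₁ y) (hg₁ y)

lemma CkConv.mul (hF : CkConv l k F f) (hG : CkConv l k G g) :
    CkConv l k (fun i y => F i y * G i y) (fun y => f y * g y) := by
  induction k generalizing F G f g with
  | zero => exact ContConv.mul hF hG
  | succ k ih =>
    have hF' := hF.of_succ
    have hG' := hG.of_succ
    obtain ⟨hF₀, hF₁, hf₁, hF₂⟩ := hF
    obtain ⟨hG₀, hG₁, hg₁, hG₂⟩ := hG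
    refine ⟨hF₀.mul hG₀, fun i => (hF₁ i).mul (hG₁ i), hf₁.mul hg₁, ?_⟩
    convert (ih hF₂ hG').add (ih hF' hG₂) using 1
    · ext i y; exact deriv_fun_mul (hF₁ i y) (hG₁ i y)
    · ext y; exact deriv_fun_mul (hf₁ y) (hg₁ y)

lemma CkConv.comp (hF : CkConv l k F f) (hG : CkConv l k G g) :
    CkConv l k (fun i y => F i (G i y)) (fun y => f (g y)) := by
  induction k generalizing F f with
  | zero => exact ContConv.comp hF hG
  | succ k ih =>
    have hG' := hG.of_succ
    obtain ⟨hF₀, hF₁, hf₁, hF₂⟩ := hF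
    obtain ⟨hG₀, hG₁, hg₁, hG₂⟩ := hG
    refine ⟨hF₀.comp hG₀, fun i => (hF₁ i).comp (hG₁ i), hf₁.comp hg₁, ?_⟩
    convert (ih hF₂ hG').mul hG₂ using 1
    · ext i y; exact deriv_comp y (hF₁ i _) (hG₁ i y)
    · ext y; exact deriv_comp y (hf₁ _) (hg₁ y)

lemma CkConv.inv (hF : CkConv l k F f) (hFne : ∀ i y, F i y ≠ 0) (hf : ∀ y, f y ≠ 0) :
    CkConv l k (fun i y => (F i y)⁻¹) (fun y => (f y)⁻¹) := by
  induction k with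
  | zero => exact ContConv.inv hF hf
  | succ k ih =>
    have hI := ih hF.of_succ
    obtain ⟨hF₀, hF₁, hf₁, hF₂⟩ := hF
    have hconst : CkConv l k (fun _ _ => (-1 : ℝ)) (fun _ => -1) := by
      have h0 : ∀ j (c : ℝ), CkConv l j (fun _ _ => c) (fun _ => c) := by
        intro j
        induction j with
        | zero => exact fun c _ => tendsto_const_nhds
        | succ j ihj =>
          intro c
          refine ⟨fun _ => tendsto_const_nhds, fun _ => differentiable_const _,
            differentiable_const _, ?_⟩
          simpa only [deriv_const'] using ihj 0
      exact h0 k _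
    refine ⟨hF₀.inv hf, fun i => (hF₁ i).inv (hFne i), hf₁.inv hf, ?_⟩
    convert (hconst.mul hF₂).mul (hI.mul hI) using 1
    · ext i y
      rw [deriv_fun_inv'' (hF₁ i y) (hFne i y)]
      field_simp
    · ext y
      rw [deriv_fun_inv'' (hf₁ y) (hf y)]
      field_simp

lemma CkConv.of_iteratedDeriv (hF : ∀ i, ContDiff ℝ k (F i)) (hf : ContDiff ℝ k f)
    (h : ∀ j ≤ k, ContConv l (fun i => iteratedDeriv j (F i)) (iteratedDeriv j f)) :
    CkConv l k F f := by
  induction k generalizing F f with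
  | zero =>
    have h0 := h 0 le_rfl
    simp only [iteratedDeriv_zero] at h0
    exact h0
  | succ k ih =>
    have h0 : ContConv l F f := by simpa using h 0 (Nat.zero_le _)
    refine ⟨h0, fun i => (hF i).differentiable (by simp), hf.differentiable (by simp), ih
      (fun i => ?_) ?_ fun j hj => ?_⟩
    · exact (contDiff_succ_iff_deriv.1 (by exact_mod_cast hF i)).2.2
    · exact (contDiff_succ_iff_deriv.1 (by exact_mod_cast hf)).2.2
    · simpa only [iteratedDeriv_succ'] using h (j + 1) (by omega)

lemma CkConv.iteratedDeriv (h : CkConv l k F f) {j : ℕ} (hj : j ≤ k) :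
    ContConv l (fun i => iteratedDeriv j (F i)) (iteratedDeriv j f) := by
  induction k generalizing F f j with
  | zero =>
    obtain rfl : j = 0 := by omega
    simpa using h.contConv
  | succ k ih =>
    cases j with
    | zero => simpa using h.contConv
    | succ j =>
      simp only [iteratedDeriv_succ']
      exact ih h.2.2.2 (by omega)

end CkConv

section Lifts

variable {r : ℕ∞} {f : ℝ → ℝ}

lemma IsCrLift.strictMono (hf : IsCrLift r f) : StrictMono f :=
  strictMono_of_deriv_pos hf.2.1

lemma IsCrLift.bijective (hf : IsCrLift r f) : Function.Bijective f := by
  refine ⟨hf.strictMono.injective, fun y => ?_⟩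
  have hint : ∀ m : ℤ, f m = f 0 + m := fun m => by simpa using apply_add_int hf.2.2 0 m
  obtain ⟨m, hm⟩ := exists_int_gt (y - f 0)
  obtain ⟨m', hm'⟩ := exists_int_lt (y - f 0)
  exact mem_range_of_exists_le_of_exists_ge hf.1.continuous
    ⟨m', by rw [hint]; linarith⟩ ⟨m, by rw [hint]; linarith⟩

lemma IsCrLift.apply_invFun (hf : IsCrLift r f) (y : ℝ) : f (Function.invFun f y) = y :=
  Function.rightInverse_invFun hf.bijective.2 y

lemma IsCrLift.invFun_add_one (hf : IsCrLift r f) (y : ℝ) :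
    Function.invFun f (y + 1) = Function.invFun f y + 1 := by
  apply hf.strictMono.injective
  rw [hf.apply_invFun, hf.2.2, hf.apply_invFun]

lemma contConv_invFun {ι : Type*} {l : Filter ι} {F : ι → ℝ → ℝ}
    (hF : ∀ i, IsCrLift r (F i)) (hf : IsCrLift r f) (h : ContConv l F f) :
    ContConv l (fun i => Function.invFun (F i)) (Function.invFun f) := by
  intro y₀
  rw [Metric.tendsto_nhds]
  intro ε hε
  set z := Function.invFun f y₀ with hz
  have hfz : f z = y₀ := hf.apply_invFun y₀
  have hlim : ∀ w, Tendsto (fun p : ι × ℝ => F p.1 w) (l ×ˢ 𝓝 y₀) (𝓝 (f w)) := fun w =>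
    (h w).comp (tendsto_fst.prodMk tendsto_const_nhds)
  have h₁ : f (z - ε) < y₀ := by rw [← hfz]; exact hf.strictMono (by linarith)
  have h₂ : y₀ < f (z + ε) := by rw [← hfz]; exact hf.strictMono (by linarith)
  filter_upwards [(hlim (z - ε)).eventually_lt tendsto_snd h₁,
    tendsto_snd.eventually_lt (hlim (z + ε)) h₂] with p hp₁ hp₂
  rw [← (hF p.1).apply_invFun p.2, (hF p.1).strictMono.lt_iff_lt] at hp₁ hp₂
  rw [Real.dist_eq, abs_lt]
  constructor <;> linarith

lemma IsCrLift.hasDerivAt_invFun (hr : 1 ≤ r) (hf : IsCrLift r f) (y : ℝ) :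
    HasDerivAt (Function.invFun f) (deriv f (Function.invFun f y))⁻¹ y := by
  have hmono : Monotone (Function.invFun f) := fun a b hab => by
    rwa [← hf.strictMono.le_iff_le, hf.apply_invFun, hf.apply_invFun]
  have hcont : ContinuousAt (Function.invFun f) y := (hmono.continuous_of_surjective
    (Function.leftInverse_invFun hf.bijective.1).surjective).continuousAt
  have hd : DifferentiableAt ℝ f (Function.invFun f y) :=
    hf.1.differentiable (by exact_mod_cast (zero_lt_one.trans_le hr).ne') _
  exact HasDerivAt.of_local_left_inverse hcont hd.hasDerivAt (hf.2.1 _).ne'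
    (Eventually.of_forall hf.apply_invFun)

/-- Inversion is continuous in the `C^k` topology. -/
lemma CkConv.invFun {ι : Type*} {l : Filter ι} {F : ι → ℝ → ℝ} {k : ℕ} (hr : 1 ≤ r)
    (hF : ∀ i, IsCrLift r (F i)) (hf : IsCrLift r f) (h : CkConv l k F f) :
    CkConv l k (fun i => Function.invFun (F i)) (Function.invFun f) := by
  induction k with
  | zero => exact contConv_invFun hF hf h
  | succ k ih =>
    have hI := ih h.of_succ
    refine ⟨hI.contConv, fun i y => ((hF i).hasDerivAt_invFun hr y).differentiableAt,
      fun y => (hf.hasDerivAt_invFun hr y).differentiableAt, ?_⟩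
    convert (h.2.2.2.comp hI).inv (fun i y => ((hF i).2.1 _).ne') (fun y => (hf.2.1 _).ne')
      using 1
    · ext i y; exact ((hF i).hasDerivAt_invFun hr y).deriv
    · ext y; exact (hf.hasDerivAt_invFun hr y).deriv

lemma periodic_iteratedDeriv_sub {f g : ℝ → ℝ} (hf : ∀ y, f (y + 1) = f y + 1)
    (hg : ∀ y, g (y + 1) = g y + 1) (k : ℕ) :
    Function.Periodic (fun y => iteratedDeriv k f y - iteratedDeriv k g y) 1 := by
  have key : ∀ {u : ℝ → ℝ}, (∀ y, u (y + 1) = u y + 1) → ∀ y,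
      iteratedDeriv k u (y + 1) = iteratedDeriv k (fun z => 1 + u z) y := by
    intro u hu y
    have := congrFun (iteratedDeriv_comp_add_const k u 1) y
    rw [← this]
    simp only [hu, add_comm]
  intro y
  simp only [key hf, key hg]
  cases k with
  | zero => simp
  | succ k => simp [iteratedDeriv_succ']

end Lifts

section Distances

lemma ContConv.of_tendsto_iSup {ι : Type*} {l : Filter ι} {A B : ι → ℝ → ℝ} {b : ℝ → ℝ}
    (hbdd : ∀ i, BddAbove (Set.range fun y => |A i y - B i y|))
    (h : Tendsto (fun i => ⨆ y, |A i y - B i y|) l (𝓝 0)) (hB : ContConv l B b) :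
    ContConv l A b := by
  intro y₀
  have h0 : Tendsto (fun p : ι × ℝ => A p.1 p.2 - B p.1 p.2) (l ×ˢ 𝓝 y₀) (𝓝 0) :=
    squeeze_zero_norm (fun p => le_ciSup (hbdd p.1) p.2) (h.comp tendsto_fst)
  simpa using h0.add (hB y₀)

lemma ContConv.tendsto_iSup {ι : Type*} {l : Filter ι} {A B : ι → ℝ → ℝ} {b : ℝ → ℝ}
    (hper : ∀ i, Function.Periodic (fun y => A i y - B i y) 1)
    (hA : ContConv l A b) (hB : ContConv l B b) :
    Tendsto (fun i => ⨆ y, |A i y - B i y|) l (𝓝 0) := by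
  rw [Metric.tendsto_nhds]
  intro ε hε
  have hloc : ∀ y₀ ∈ Set.Icc (0 : ℝ) 1,
      {p : ι × ℝ | |A p.1 p.2 - B p.1 p.2| < ε / 2} ∈ l ×ˢ 𝓝 y₀ := by
    intro y₀ _
    have := (hA y₀).sub (hB y₀)
    rw [sub_self, Metric.tendsto_nhds] at this
    simpa only [Real.dist_0_eq_abs] using! this (ε / 2) (half_pos hε)
  obtain ⟨U, hU, V, hV, hUV⟩ :=
    Filter.mem_prod_iff.1 (isCompact_Icc.mem_prod_nhdsSet_of_forall hloc)
  filter_upwards [hU] with i hi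
  rw [Real.dist_0_eq_abs, abs_of_nonneg (Real.iSup_nonneg fun _ => abs_nonneg _)]
  refine (ciSup_le fun y => ?_).trans_lt (half_lt_self hε)
  obtain ⟨z, hz, hyz⟩ := (hper i).exists_mem_Ico₀ one_pos y
  change A i y - B i y = A i z - B i z at hyz
  rw [hyz]
  exact (hUV (Set.mk_mem_prod hi (subset_of_mem_nhdsSet hV (Set.Ico_subset_Icc_self hz)))).le

lemma bddAbove_abs_of_periodic {u : ℝ → ℝ} (hu : Continuous u) (hper : Function.Periodic u 1) :
    BddAbove (Set.range fun y => |u y|) := by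
  obtain ⟨C, hC⟩ := isCompact_Icc.exists_bound_of_continuousOn (s := Set.Icc (0 : ℝ) 1)
    hu.continuousOn
  refine ⟨C, ?_⟩
  rintro _ ⟨y, rfl⟩
  obtain ⟨z, hz, hyz⟩ := hper.exists_mem_Ico₀ one_pos y
  simp only [hyz]
  exact hC z (Set.Ico_subset_Icc_self hz)

lemma crDist_nonneg (r : ℕ) (f g : ℝ → ℝ) : 0 ≤ crDist r f g :=
  Finset.sum_nonneg fun _ _ => Real.iSup_nonneg fun _ => abs_nonneg _

lemma crDist_comm (r : ℕ) (f g : ℝ → ℝ) : crDist r f g = crDist r g f := by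
  simp only [crDist, abs_sub_comm]

lemma liftDist_nonneg (r : ℕ) (f g : ℝ → ℝ) : 0 ≤ liftDist r f g :=
  add_nonneg (crDist_nonneg _ _ _) (crDist_nonneg _ _ _)

lemma liftDist_comm (r : ℕ) (f g : ℝ → ℝ) : liftDist r f g = liftDist r g f := by
  simp only [liftDist, crDist_comm r f g, crDist_comm r (Function.invFun f)]

lemma iSup_le_liftDist {r k : ℕ} (hk : k ≤ r) (f g : ℝ → ℝ) :
    ⨆ y, |iteratedDeriv k f y - iteratedDeriv k g y| ≤ liftDist r f g :=
  (Finset.single_le_sum (f := fun k => ⨆ y : ℝ, |iteratedDeriv k f y - iteratedDeriv k g y|)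
    (fun _ _ => Real.iSup_nonneg fun _ => abs_nonneg _)
    (Finset.mem_range.2 (Nat.lt_succ_of_le hk))).trans
    (le_add_of_nonneg_right (crDist_nonneg _ _ _))

lemma liftDistInf_term_nonneg (f g : ℝ → ℝ) (k : ℕ) :
    0 ≤ (2 : ℝ)⁻¹ ^ (k + 1) * (liftDist (k + 1) f g / (liftDist (k + 1) f g + 1)) := by
  have := liftDist_nonneg (k + 1) f g
  positivity

lemma liftDistInf_term_le (f g : ℝ → ℝ) (k : ℕ) :
    (2 : ℝ)⁻¹ ^ (k + 1) * (liftDist (k + 1) f g / (liftDist (k + 1) f g + 1)) ≤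
      (2 : ℝ)⁻¹ ^ (k + 1) := by
  have := liftDist_nonneg (k + 1) f g
  refine mul_le_of_le_one_right (by positivity) ?_
  rw [div_le_one (by positivity)]
  linarith

lemma summable_inv_two_pow_succ : Summable fun k : ℕ => (2 : ℝ)⁻¹ ^ (k + 1) :=
  (summable_nat_add_iff 1).2 (summable_geometric_of_lt_one (by norm_num) (by norm_num))

lemma liftDistInf_nonneg (f g : ℝ → ℝ) : 0 ≤ liftDistInf f g :=
  tsum_nonneg (liftDistInf_term_nonneg f g)

lemma liftDistInf_comm (f g : ℝ → ℝ) : liftDistInf f g = liftDistInf g f := by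
  simp only [liftDistInf, liftDist_comm _ f g]

lemma tendsto_liftDist_of_liftDistInf {ι : Type*} {l : Filter ι} {F G : ι → ℝ → ℝ}
    (h : Tendsto (fun i => liftDistInf (F i) (G i)) l (𝓝 0)) (k : ℕ) :
    Tendsto (fun i => liftDist (k + 1) (F i) (G i)) l (𝓝 0) := by
  set q : ι → ℝ := fun i => liftDist (k + 1) (F i) (G i) / (liftDist (k + 1) (F i) (G i) + 1)
  have hterm : Tendsto (fun i => (2 : ℝ)⁻¹ ^ (k + 1) * q i) l (𝓝 0) :=
    squeeze_zero (fun i => liftDistInf_term_nonneg _ _ k)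
      (fun i => (summable_inv_two_pow_succ.of_nonneg_of_le (liftDistInf_term_nonneg _ _)
        (liftDistInf_term_le _ _)).le_tsum k fun j _ => liftDistInf_term_nonneg _ _ j) h
  have hq : Tendsto q l (𝓝 0) := by
    have := hterm.const_mul ((2 : ℝ) ^ (k + 1))
    simpa [← mul_assoc, ← mul_pow] using this
  have hlim : Tendsto (fun i => q i / (1 - q i)) l (𝓝 0) := by
    simpa using! hq.div (hq.const_sub 1) (by norm_num)
  refine hlim.congr fun i => ?_
  have hpos : liftDist (k + 1) (F i) (G i) + 1 ≠ 0 := by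
    have := liftDist_nonneg (k + 1) (F i) (G i)
    positivity
  simp only [q]
  field_simp
  simp

lemma tendsto_liftDistInf {ι : Type*} {l : Filter ι} {F G : ι → ℝ → ℝ}
    (h : ∀ k, Tendsto (fun i => liftDist k (F i) (G i)) l (𝓝 0)) :
    Tendsto (fun i => liftDistInf (F i) (G i)) l (𝓝 0) := by
  have := tendsto_tsum_of_dominated_convergence (𝓕 := l)
    (f := fun i k => (2 : ℝ)⁻¹ ^ (k + 1) *
      (liftDist (k + 1) (F i) (G i) / (liftDist (k + 1) (F i) (G i) + 1)))
    (g := fun _ => 0) summable_inv_two_pow_succ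
    (fun k => by
      have := ((h (k + 1)).div ((h (k + 1)).add_const 1) (by norm_num)).const_mul
        ((2 : ℝ)⁻¹ ^ (k + 1))
      simpa using this)
    (Eventually.of_forall fun i k => by
      rw [Real.norm_of_nonneg (liftDistInf_term_nonneg _ _ k)]
      exact liftDistInf_term_le _ _ k)
  simpa [liftDistInf] using this

variable {ι : Type*} {l : Filter ι} {r : ℕ∞} {F G : ι → ℝ → ℝ} {f : ℝ → ℝ} {n : ℕ}

lemma contConv_of_tendsto_liftDist (hF : ∀ i, IsCrLift r (F i)) (hG : ∀ i, IsCrLift r (G i))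
    (hn : (n : ℕ∞) ≤ r) (h : Tendsto (fun i => liftDist n (F i) (G i)) l (𝓝 0)) {k : ℕ}
    (hk : k ≤ n) (hGf : ContConv l (fun i => iteratedDeriv k (G i)) (iteratedDeriv k f)) :
    ContConv l (fun i => iteratedDeriv k (F i)) (iteratedDeriv k f) := by
  have hkr : ((k : ℕ∞) : WithTop ℕ∞) ≤ r := by
    exact_mod_cast (Nat.cast_le.2 hk).trans hn
  refine ContConv.of_tendsto_iSup (fun i => ?_) ?_ hGf
  · exact bddAbove_abs_of_periodic
      (((hF i).1.continuous_iteratedDeriv k hkr).sub ((hG i).1.continuous_iteratedDeriv k hkr))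
      (periodic_iteratedDeriv_sub (hF i).2.2 (hG i).2.2 k)
  · exact squeeze_zero (fun i => Real.iSup_nonneg fun _ => abs_nonneg _)
      (fun i => iSup_le_liftDist hk _ _) h

lemma CkConv.tendsto_crDist (hF : ∀ i y, F i (y + 1) = F i y + 1)
    (hG : ∀ i y, G i (y + 1) = G i y + 1) (hFf : CkConv l n F f) (hGf : CkConv l n G f) :
    Tendsto (fun i => crDist n (F i) (G i)) l (𝓝 0) := by
  have := tendsto_finsetSum (Finset.range (n + 1)) fun k hk =>
    ContConv.tendsto_iSup (fun i => periodic_iteratedDeriv_sub (hF i) (hG i) k)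
      (hFf.iteratedDeriv (Nat.le_of_lt_succ (Finset.mem_range.1 hk)))
      (hGf.iteratedDeriv (Nat.le_of_lt_succ (Finset.mem_range.1 hk)))
  simpa [crDist] using this

lemma tendsto_liftDist_of_contConv (hr : 1 ≤ r) (hF : ∀ i, IsCrLift r (F i))
    (hG : ∀ i, IsCrLift r (G i)) (hf : IsCrLift r f) (hn : (n : ℕ∞) ≤ r)
    (hFf : ∀ k ≤ n, ContConv l (fun i => iteratedDeriv k (F i)) (iteratedDeriv k f))
    (hGf : ∀ k ≤ n, ContConv l (fun i => iteratedDeriv k (G i)) (iteratedDeriv k f)) :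
    Tendsto (fun i => liftDist n (F i) (G i)) l (𝓝 0) := by
  have hnr : ((n : ℕ∞) : WithTop ℕ∞) ≤ r := by exact_mod_cast hn
  have hF' : CkConv l n F f :=
    .of_iteratedDeriv (fun i => (hF i).1.of_le hnr) (hf.1.of_le hnr) hFf
  have hG' : CkConv l n G f :=
    .of_iteratedDeriv (fun i => (hG i).1.of_le hnr) (hf.1.of_le hnr) hGf
  have h₁ := hF'.tendsto_crDist (fun i => (hF i).2.2) (fun i => (hG i).2.2) hG'
  have h₂ := (hF'.invFun hr hF hf).tendsto_crDist (fun i => (hF i).invFun_add_one)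
    (fun i => (hG i).invFun_add_one) (hG'.invFun hr hG hf)
  simpa [liftDist] using h₁.add h₂

end Distances

section Models

lemma IsCrLift.convexComb {r : ℕ∞} (hr : 1 ≤ r) {f g : ℝ → ℝ} (hf : IsCrLift r f)
    (hg : IsCrLift r g) (t : unitInterval) :
    IsCrLift r (fun y => (1 - t) * f y + t * g y) := by
  have h0 : (r : WithTop ℕ∞) ≠ 0 := by exact_mod_cast (zero_lt_one.trans_le hr).ne'
  refine ⟨(contDiff_const.mul hf.1).add (contDiff_const.mul hg.1), fun y => ?_, fun y => ?_⟩
  · have hdf := (hf.1.differentiable h0 y).hasDerivAt.const_mul (1 - (t : ℝ))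
    have hdg := (hg.1.differentiable h0 y).hasDerivAt.const_mul (t : ℝ)
    rw [(hdf.fun_add hdg).deriv]
    exact (convex_Ioi (0 : ℝ)) (hf.2.1 y) (hg.2.1 y) (sub_nonneg.2 t.2.2) t.2.1 (by ring)
  · simp only [hf.2.2, hg.2.2]
    ring

lemma iteratedDeriv_convexComb {k : ℕ} {f g : ℝ → ℝ} (hf : ContDiff ℝ k f)
    (hg : ContDiff ℝ k g) (t y : ℝ) :
    iteratedDeriv k (fun y => (1 - t) * f y + t * g y) y =
      (1 - t) * iteratedDeriv k f y + t * iteratedDeriv k g y := by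
  rw [iteratedDeriv_fun_add (contDiff_const.mul hf).contDiffAt
    (contDiff_const.mul hg).contDiffAt, iteratedDeriv_const_mul _ hf.contDiffAt,
    iteratedDeriv_const_mul _ hg.contDiffAt]

lemma HData.IsExampleI.nonempty_convexModel {hd : HData} (h : hd.IsExampleI) :
    Nonempty (ConvexModel hd) := by
  obtain ⟨r, hr, e, -, hfin, htop⟩ := h
  have hle : ∀ k ∈ {k : ℕ | (k : ℕ∞) ≤ r}, ((k : ℕ∞) : WithTop ℕ∞) ≤ r := fun k hk => by
    exact_mod_cast hk
  rcases eq_or_ne r ⊤ with hrt | hrt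
  · have hdist := htop hrt
    exact ⟨{
      S := {k | (k : ℕ∞) ≤ r}
      J := fun k h => iteratedDeriv k (e h).1
      mix := fun a b t => e.symm ⟨_, (e a).2.convexComb hr (e b).2 t⟩
      mix_zero := fun a b => by simp
      mix_one := fun a b => by simp
      J_mix := fun k hk a b t y => by
        simpa using iteratedDeriv_convexComb ((e a).2.1.of_le (hle k hk))
          ((e b).2.1.of_le (hle k hk)) t y
      J_cont := fun k hk h => (e h).2.1.continuous_iteratedDeriv k (hle k hk)
      dist_comm := fun a b => by rw [hdist, hdist, liftDistInf_comm]
      dist_nonneg := fun a b => by rw [hdist]; exact liftDistInf_nonneg _ _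
      conv_of_dist := fun l F G f h hG k hk => by
        simp only [hdist] at h
        exact contConv_of_tendsto_liftDist (fun i => (e (F i)).2) (fun i => (e (G i)).2)
          (n := k + 1) (by simp [hrt]) (tendsto_liftDist_of_liftDistInf h k) k.le_succ (hG k hk)
      dist_of_conv := fun l F G f hF hG => by
        simp only [hdist]
        refine tendsto_liftDistInf fun n => tendsto_liftDist_of_contConv hr
          (fun i => (e (F i)).2) (fun i => (e (G i)).2) (e f).2 (by simp [hrt])
          (fun k _ => hF k (by simp [hrt])) (fun k _ => hG k (by simp [hrt])) }⟩
  · obtain ⟨n, hn⟩ := ENat.ne_top_iff_exists.1 hrt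
    have hdist := hfin n hn.symm
    exact ⟨{
      S := {k | (k : ℕ∞) ≤ r}
      J := fun k h => iteratedDeriv k (e h).1
      mix := fun a b t => e.symm ⟨_, (e a).2.convexComb hr (e b).2 t⟩
      mix_zero := fun a b => by simp
      mix_one := fun a b => by simp
      J_mix := fun k hk a b t y => by
        simpa using iteratedDeriv_convexComb ((e a).2.1.of_le (hle k hk))
          ((e b).2.1.of_le (hle k hk)) t y
      J_cont := fun k hk h => (e h).2.1.continuous_iteratedDeriv k (hle k hk)
      dist_comm := fun a b => by rw [hdist, hdist, liftDist_comm]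
      dist_nonneg := fun a b => by rw [hdist]; exact liftDist_nonneg _ _ _
      conv_of_dist := fun l F G f h hG k hk => by
        simp only [hdist] at h
        exact contConv_of_tendsto_liftDist (fun i => (e (F i)).2) (fun i => (e (G i)).2)
          hn.le h (by rw [Set.mem_ofPred_eq, ← hn] at hk; exact_mod_cast hk) (hG k hk)
      dist_of_conv := fun l F G f hF hG => by
        simp only [hdist]
        have hkr : ∀ k ≤ n, (k : ℕ∞) ≤ r := fun k hk => hn ▸ Nat.cast_le.2 hk
        exact tendsto_liftDist_of_contConv hr (fun i => (e (F i)).2) (fun i => (e (G i)).2)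
          (e f).2 hn.le (fun k hk => hF k (hkr k hk)) (fun k hk => hG k (hkr k hk)) }⟩

lemma HData.IsExampleII.nonempty_convexModel {hd : HData} (h : hd.IsExampleII) :
    Nonempty (ConvexModel hd) := by
  obtain ⟨P, e, ⟨-, hdist, -⟩, -⟩ := h
  have hiff : ∀ {ι : Type} (l : Filter ι) (F : ι → hd.H) (f : hd.H),
      ContConv l (fun i _ => e (F i)) (fun _ => e f) ↔ Tendsto (fun i => e (F i)) l (𝓝 (e f)) :=
    fun l F f => ⟨fun hc => (hc 0).comp (tendsto_id.prodMk tendsto_const_nhds),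
      fun hc y => hc.comp tendsto_fst⟩
  exact ⟨{
    S := Set.univ
    J := fun _ h _ => e h
    mix := fun a b t => e.symm ((1 - t) * e a + t * e b)
    mix_zero := fun a b => by simp
    mix_one := fun a b => by simp
    J_mix := fun k hk a b t y => by simp
    J_cont := fun k hk h => continuous_const
    dist_comm := fun a b => by rw [hdist, hdist, abs_sub_comm]
    dist_nonneg := fun a b => by rw [hdist]; exact abs_nonneg _
    conv_of_dist := fun l F G f h hG k hk => by
      simp only [hdist] at h
      have := (tendsto_zero_iff_abs_tendsto_zero _).2 h
      rw [hiff]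
      simpa using this.add ((hiff l G f).1 (hG k hk))
    dist_of_conv := fun l F G f hF hG => by
      simp only [hdist]
      have := ((hiff l F f).1 (hF 0 trivial)).sub ((hiff l G f).1 (hG 0 trivial))
      rw [sub_self] at this
      exact (tendsto_zero_iff_abs_tendsto_zero _).1 this }⟩

end Models

end Growth

end ForcedCircle

namespace ForcedCircle

/-- pointwise version of the uniform growth lemma, for tuples
`(H_i)` close to the orbit values `H(gⁱx)`, with arbitrary lifts `F_i`. -/
theorem uniform_growth_tuples
    {X : Type} [MetricSpace X] [CompactSpace X] [MeasurableSpace X] [BorelSpace X]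
    (g : X ≃ₜ X) (hue : UniquelyErgodic (⇑g)) (hmin : Minimal (⇑g))
    (hfac : HasFinDimNonperiodicFactor (⇑g))
    (hd : HData) (hex : hd.IsExampleI ∨ hd.IsExampleII)
    (H : X → hd.H) (hH : ContH hd H) (hml : ¬ InClosureML hd (⇑g) H)
    (κ₀ : ℝ) (hκ₀ : 0 < κ₀) (Δ K : ℝ → ℝ)
    (hpos : ∀ ε : ℝ, 0 < ε → 0 < Δ ε ∧ 0 < K ε)
    (hgrowth : ∀ ε : ℝ, 0 < ε → ∀ n : ℕ, K ε < (n : ℝ) →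
      ∀ H' : X → hd.H, ContH hd H' → DH hd H H' < κ₀ →
      ∀ F' : X → ℝ → ℝ, IsLiftOfPhi hd H' F' → ∀ x : X,
        (n : ℝ) * Δ ε < ⨅ y : ℝ,
          (fiberIter (⇑g) (fun x' u => F' x' u + ε) n x y - fiberIter (⇑g) F' n x y)) :
    ∃ κ : ℝ, 0 < κ ∧ ∀ ε : ℝ, 0 < ε → ∀ n : ℕ, K ε < (n : ℝ) →
      ∀ (x : X) (p : Fin n → hd.H),
        (∀ i : Fin n, hd.dist (p i) (H ((⇑g)^[(i : ℕ)] x)) < κ) →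
        ∀ a : Fin n → ℤ,
          (n : ℝ) * Δ ε < ⨅ y : ℝ,
            (compList (List.ofFn fun i : Fin n => fun u => hd.iota (p i) u + (a i : ℝ) + ε) y -
              compList (List.ofFn fun i : Fin n => fun u => hd.iota (p i) u + (a i : ℝ)) y) := by
  obtain ⟨M⟩ : Nonempty (ConvexModel hd) := hex.elim
    HData.IsExampleI.nonempty_convexModel HData.IsExampleII.nonempty_convexModel
  have := infinite_of_factor hfac
  obtain ⟨κ, hκ, hext⟩ := M.exists_extension hH hκ₀
  refine ⟨κ, hκ, fun ε hε n hn x p hp a => ?_⟩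
  have hinj : Function.Injective fun i : Fin n => (⇑g)^[(i : ℕ)] x :=
    (iterate_injective_of_minimal g.injective hmin x).comp Fin.val_injective
  obtain ⟨H', hH', hclose, hval⟩ := hext _ p hinj hp
  have hper : ∀ x' y, Phi hd H' x' (y + 1) = Phi hd H' x' y + 1 := fun x' =>
    (hd.iota_lift (H' x')).2.2
  have hmain := hgrowth ε hε n hn H' hH' hclose (Phi hd H')
    ⟨fun _ => 0, continuous_const, by simp [Phi]⟩ x
  have h₁ := fun y => compList_ofFn_add_int (⇑g) (Phi hd H') hper n x y a
  have h₂ := fun y => compList_ofFn_add_int (⇑g) (fun x' u => Phi hd H' x' u + ε)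
    (fun x' y => by rw [hper, add_right_comm]) n x y a
  simp only [Phi, hval] at h₁ h₂
  simp only [add_right_comm _ ε] at h₂
  simp only [h₁, h₂, add_sub_add_right_eq_sub]
  exact hmain

end ForcedCircle
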